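/- For every h ∈ (−1,0) one has Ī₀(h) > 0, and the function v(h) = Ī₂(h)/Ī₀(h) is differentiable on (−1,0) with v′(h) < 0 for all h ∈ (−1,0); moreover v(h) → 1 as h → −1⁺ and v(h) → 4/5 as h → 0⁻. -/

import Mathlib

open intervalIntegral Real Filter

/-- `Ī_k(h) = ∫_{u₁(h)}^{u₂(h)} u^k √(h + 2u² − u⁴) du` where
`u₁(h) = √(1 − √(1+h))` and `u₂(h) = √(1 + √(1+h))`. -/
noncomputable def Ibar (k : ℕ) (h : ℝ) : ℝ :=
  ∫ u in (Real.sqrt (1 - Real.sqrt (1 + h)))..(Real.sqrt (1 + Real.sqrt (1 + h))),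
    u ^ k * Real.sqrt (h + 2 * u ^ 2 - u ^ 4)

/-- The integral `∫_{-1}^{1} (1 + s x)^p √(1 - x²) dx`. -/
noncomputable def semicircleIntegral (p s : ℝ) : ℝ :=
  ∫ x in (-1 : ℝ)..1, (1 + s * x) ^ p * √(1 - x ^ 2)

lemma one_sub_abs_le_one_add_mul {s x : ℝ} (hx : x ∈ Set.Icc (-1 : ℝ) 1) :
    1 - |s| ≤ 1 + s * x := by
  have h1 : |s * x| ≤ |s| := by
    rw [abs_mul]
    exact mul_le_of_le_one_right (abs_nonneg s) (abs_le.mpr hx)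
  linarith [neg_abs_le (s * x)]

lemma one_add_mul_pos {s x : ℝ} (hs : |s| < 1) (hx : x ∈ Set.Icc (-1 : ℝ) 1) :
    0 < 1 + s * x := by
  linarith [one_sub_abs_le_one_add_mul (s := s) hx]

lemma continuousOn_one_add_mul_rpow (p : ℝ) {s : ℝ} (hs : |s| < 1) :
    ContinuousOn (fun x => (1 + s * x) ^ p) (Set.Icc (-1) 1) :=
  ContinuousOn.rpow_const (by fun_prop) fun _ hx => Or.inl (one_add_mul_pos hs hx).ne'

lemma intervalIntegrable_semicircle (p : ℝ) {s : ℝ} (hs : |s| < 1) :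
    IntervalIntegrable (fun x => (1 + s * x) ^ p * √(1 - x ^ 2)) MeasureTheory.volume (-1) 1 := by
  apply ContinuousOn.intervalIntegrable_of_Icc (by norm_num)
  exact (continuousOn_one_add_mul_rpow p hs).mul (by fun_prop)

lemma semicircleIntegral_pos (p : ℝ) {s : ℝ} (hs : |s| < 1) : 0 < semicircleIntegral p s := by
  refine intervalIntegral_pos_of_pos_on (intervalIntegrable_semicircle p hs) ?_ (by norm_num)
  intro x hx
  have h1 := one_add_mul_pos hs (Set.Ioo_subset_Icc_self hx)
  have h2 : 0 < 1 - x ^ 2 := by nlinarith [hx.1, hx.2]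
  positivity

lemma hasDerivAt_semicircleIntegral (p : ℝ) {s : ℝ} (hs : |s| < 1) :
    HasDerivAt (semicircleIntegral p)
      (p * ∫ x in (-1 : ℝ)..1, x * (1 + s * x) ^ (p - 1) * √(1 - x ^ 2)) s := by
  obtain ⟨r, hsr, hr⟩ := exists_between hs
  have hnhds : {t : ℝ | |t| < r} ∈ nhds s :=
    (isOpen_lt continuous_abs continuous_const).mem_nhds hsr
  obtain ⟨C, hC⟩ := (isCompact_Icc (a := 1 - r) (b := 1 + r)).exists_bound_of_continuousOn
    (f := fun y : ℝ => y ^ (p - 1))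
    (ContinuousOn.rpow_const continuousOn_id fun y hy => Or.inl (by
      have : 0 < y := by linarith [hy.1]
      exact this.ne'))
  have key := hasDerivAt_integral_of_dominated_loc_of_deriv_le
    (μ := MeasureTheory.volume) (a := (-1 : ℝ)) (b := 1) (x₀ := s)
    (F := fun s x => (1 + s * x) ^ p * √(1 - x ^ 2))
    (F' := fun s x => p * (x * (1 + s * x) ^ (p - 1) * √(1 - x ^ 2)))
    (bound := fun _ => |p| * C) hnhds ?_ (intervalIntegrable_semicircle p hs) ?_ ?_
    intervalIntegrable_const ?_
  · rw [← integral_const_mul]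
    exact key.2
  · filter_upwards [hnhds] with t ht
    exact (intervalIntegrable_iff.mp
      (intervalIntegrable_semicircle p (lt_trans ht hr))).aestronglyMeasurable
  · refine (intervalIntegrable_iff.mp
      (ContinuousOn.intervalIntegrable_of_Icc (by norm_num) ?_)).aestronglyMeasurable
    exact continuousOn_const.mul
      ((continuousOn_id.mul (continuousOn_one_add_mul_rpow (p - 1) hs)).mul (by fun_prop))
  · refine .of_forall fun x hx t ht => ?_
    rw [Set.uIoc_of_le (by norm_num)] at hx
    have hx' := Set.Ioc_subset_Icc_self hx
    have htr : |t| < r := ht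
    have hlow := one_sub_abs_le_one_add_mul (s := t) hx'
    have hupp := one_sub_abs_le_one_add_mul (s := -t) hx'
    rw [abs_neg] at hupp
    have hb := hC (1 + t * x) ⟨by linarith, by linarith⟩
    have hx1 : ‖x‖ ≤ 1 := abs_le.mpr hx'
    have hw : ‖√(1 - x ^ 2)‖ ≤ 1 := by
      rw [norm_of_nonneg (sqrt_nonneg _)]
      exact sqrt_le_one.mpr (by nlinarith [sq_nonneg x])
    have hC0 : 0 ≤ C := (norm_nonneg _).trans hb
    simp only [norm_mul]
    calc ‖p‖ * (‖x‖ * ‖(1 + t * x) ^ (p - 1)‖ * ‖√(1 - x ^ 2)‖)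
        ≤ ‖p‖ * (1 * C * 1) := by gcongr
      _ = |p| * C := by rw [norm_eq_abs]; ring
  · refine .of_forall fun x hx t ht => ?_
    rw [Set.uIoc_of_le (by norm_num)] at hx
    have hpos := one_add_mul_pos (lt_trans ht hr) (Set.Ioc_subset_Icc_self hx)
    have h1 : HasDerivAt (fun t : ℝ => 1 + t * x) x t := by
      simpa using ((hasDerivAt_id t).mul_const x).const_add 1
    refine ((h1.rpow_const (p := p) (Or.inl hpos.ne')).mul_const (√(1 - x ^ 2))).congr_deriv ?_
    ring

lemma integral_mul_one_add_mul_rpow_neg {q s : ℝ} (hq : q < 0) (hs : s ∈ Set.Ioo (0 : ℝ) 1) :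
    ∫ x in (-1 : ℝ)..1, x * (1 + s * x) ^ q * √(1 - x ^ 2) < 0 := by
  have habs : |s| < 1 := by rw [abs_of_pos hs.1]; exact hs.2
  set f : ℝ → ℝ := fun x => x * (1 + s * x) ^ q * √(1 - x ^ 2) with hf
  have hcont : ContinuousOn f (Set.Icc (-1) 1) :=
    (continuousOn_id.mul (continuousOn_one_add_mul_rpow q habs)).mul (by fun_prop)
  have hleft : IntervalIntegrable f MeasureTheory.volume (-1) 0 :=
    (hcont.mono (Set.Icc_subset_Icc_right (by norm_num))).intervalIntegrable_of_Icc (by norm_num)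
  have hright : IntervalIntegrable f MeasureTheory.volume 0 1 :=
    (hcont.mono (Set.Icc_subset_Icc_left (by norm_num))).intervalIntegrable_of_Icc (by norm_num)
  have hreflect : IntervalIntegrable (fun x => f (-x)) MeasureTheory.volume 0 1 := by
    apply ContinuousOn.intervalIntegrable_of_Icc (by norm_num)
    exact hcont.comp continuousOn_neg fun x hx => ⟨by linarith [hx.2], by linarith [hx.1]⟩
  have hfold : ∫ x in (-1 : ℝ)..0, f x = ∫ x in (0 : ℝ)..1, f (-x) := by
    rw [integral_comp_neg]; simp
  rw [← integral_add_adjacent_intervals hleft hright, hfold,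
    ← integral_add hreflect hright, ← neg_pos, ← integral_neg]
  refine intervalIntegral_pos_of_pos_on (hreflect.add hright).neg ?_ (by norm_num)
  intro x hx
  have hw : 0 < √(1 - x ^ 2) := sqrt_pos.mpr (by nlinarith [hx.1, hx.2])
  have hsx : 0 < s * x := mul_pos hs.1 hx.1
  have hpos : 0 < 1 - s * x := by nlinarith [hx.1, hx.2, hs.1, hs.2]
  have hlt : (1 + s * x) ^ q < (1 - s * x) ^ q :=
    rpow_lt_rpow_of_neg hpos (by linarith) hq
  have heq : -(f (-x) + f x) = x * ((1 - s * x) ^ q - (1 + s * x) ^ q) * √(1 - x ^ 2) := by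
    simp only [hf, neg_sq, mul_neg, ← sub_eq_add_neg]
    ring
  rw [heq]
  exact mul_pos (mul_pos hx.1 (sub_pos.mpr hlt)) hw

lemma Ibar_eq_semicircleIntegral (k : ℕ) {h : ℝ} (hh : h ∈ Set.Ioo (-1 : ℝ) 0) :
    Ibar k h = (1 + h) / 2 * semicircleIntegral (((k : ℝ) - 1) / 2) (√(1 + h)) := by
  set s := √(1 + h) with hs
  have hs2 : s ^ 2 = 1 + h := sq_sqrt (by linarith [hh.1])
  have hs0 : 0 < s := sqrt_pos.mpr (by linarith [hh.1])
  have hs1 : |s| < 1 := by rw [abs_of_pos hs0]; nlinarith [hh.2]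
  have hpos : ∀ x ∈ Set.uIcc (-1 : ℝ) 1, 0 < 1 + s * x := fun x hx =>
    one_add_mul_pos hs1 (by rwa [Set.uIcc_of_le (by norm_num)] at hx)
  have hsubst := integral_comp_mul_deriv (a := -1) (b := 1)
    (f := fun x => √(1 + s * x)) (f' := fun x => s / (2 * √(1 + s * x)))
    (g := fun u => u ^ k * √(h + 2 * u ^ 2 - u ^ 4))
    (fun x hx => by
      have h1 : HasDerivAt (fun x : ℝ => 1 + s * x) s x := by
        simpa using ((hasDerivAt_id x).const_mul s).const_add 1
      exact h1.sqrt (hpos x hx).ne')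
    (by
      apply ContinuousOn.div continuousOn_const (by fun_prop)
      intro x hx
      have := sqrt_pos.mpr (hpos x hx)
      positivity)
    (by fun_prop)
  rw [Ibar, ← hs, sub_eq_add_neg]
  simp only [mul_one, mul_neg] at hsubst
  rw [← hsubst, semicircleIntegral, ← integral_const_mul]
  refine integral_congr fun x hx => ?_
  have hy := hpos x hx
  set y := 1 + s * x with hydef
  have hrad : h + 2 * √y ^ 2 - √y ^ 4 = s ^ 2 * (1 - x ^ 2) := by
    have h4 : √y ^ 4 = y ^ 2 := by
      rw [show √y ^ 4 = (√y ^ 2) ^ 2 by ring, sq_sqrt hy.le]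
    rw [h4, sq_sqrt hy.le, eq_sub_of_add_eq' hs2.symm, hydef]
    ring
  have hpow : y ^ (((k : ℝ) - 1) / 2) = √y ^ k / √y := by
    rw [sqrt_eq_rpow, ← rpow_natCast, ← rpow_mul hy.le, ← rpow_sub hy]
    ring_nf
  simp only [Function.comp_apply, ← hydef]
  rw [hrad, sqrt_mul (sq_nonneg s), sqrt_sq hs0.le, hpow, ← hs2]
  ring

lemma semicircleIntegral_half_one :
    semicircleIntegral (1 / 2) 1 = 4 / 5 * ((2 : ℝ) ^ (3 / 2 : ℝ) * (2 / 3)) := by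
  have h1 : semicircleIntegral (1 / 2) 1 = ∫ x in (-1 : ℝ)..1,
      (fun y : ℝ => 2 * y ^ (1 / 2 : ℝ) - y ^ (3 / 2 : ℝ)) (1 - x) := by
    refine integral_congr fun x hx => ?_
    rw [Set.uIcc_of_le (by norm_num)] at hx
    have hp : 0 ≤ 1 + x := by linarith [hx.1]
    have hm : 0 ≤ 1 - x := by linarith [hx.2]
    have h3 : (1 - x) ^ (3 / 2 : ℝ) = (1 - x) * √(1 - x) := by
      rw [show (3 / 2 : ℝ) = 1 + 1 / 2 by norm_num,
        rpow_add_of_nonneg hm (by norm_num) (by norm_num), rpow_one, sqrt_eq_rpow]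
    simp only [one_mul]
    rw [show 1 - x ^ 2 = (1 + x) * (1 - x) by ring, sqrt_mul hp, h3, ← sqrt_eq_rpow,
      ← sqrt_eq_rpow, ← mul_assoc, mul_self_sqrt hp]
    ring
  have h5 : (2 : ℝ) ^ (5 / 2 : ℝ) = 2 * 2 ^ (3 / 2 : ℝ) := by
    rw [show (5 / 2 : ℝ) = 1 + 3 / 2 by norm_num, rpow_add two_pos, rpow_one]
  rw [h1, integral_comp_sub_left (fun y : ℝ => 2 * y ^ (1 / 2 : ℝ) - y ^ (3 / 2 : ℝ)),
    integral_sub ((intervalIntegrable_rpow' (by norm_num)).const_mul 2)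
      (intervalIntegrable_rpow' (by norm_num)), integral_const_mul,
    integral_rpow (Or.inl (by norm_num)), integral_rpow (Or.inl (by norm_num))]
  norm_num [h5]
  ring

lemma semicircleIntegral_neg_half_one :
    semicircleIntegral (-1 / 2) 1 = (2 : ℝ) ^ (3 / 2 : ℝ) * (2 / 3) := by
  have h1 : semicircleIntegral (-1 / 2) 1 = ∫ x in (-1 : ℝ)..1,
      (fun y : ℝ => y ^ (1 / 2 : ℝ)) (1 - x) := by
    refine integral_congr_ae (.of_forall fun x hx => ?_)
    rw [Set.uIoc_of_le (by norm_num)] at hx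
    have hp : 0 < 1 + x := by linarith [hx.1]
    simp only [one_mul]
    rw [show 1 - x ^ 2 = (1 + x) * (1 - x) by ring, sqrt_mul hp.le,
      show (-1 / 2 : ℝ) = -(1 / 2) by norm_num, rpow_neg hp.le, ← sqrt_eq_rpow, ← sqrt_eq_rpow,
      inv_mul_cancel_left₀ (sqrt_pos.mpr hp).ne']
  rw [h1, integral_comp_sub_left (fun y : ℝ => y ^ (1 / 2 : ℝ)),
    integral_rpow (Or.inl (by norm_num))]
  norm_num
  ring

lemma tendsto_semicircleIntegral_half :
    Tendsto (semicircleIntegral (1 / 2)) (nhdsWithin 1 (Set.Ioo 0 1))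
      (nhds (semicircleIntegral (1 / 2) 1)) := by
  refine Tendsto.mono_left (Continuous.tendsto ?_ 1) nhdsWithin_le_nhds
  refine continuous_parametric_intervalIntegral_of_continuous'
    (f := fun s x : ℝ => (1 + s * x) ^ (1 / 2 : ℝ) * √(1 - x ^ 2)) ?_ (-1) 1
  refine Continuous.mul (Continuous.rpow_const (by fun_prop) fun _ => Or.inr (by norm_num)) ?_
  fun_prop

lemma tendsto_semicircleIntegral_neg_half :
    Tendsto (semicircleIntegral (-1 / 2)) (nhdsWithin 1 (Set.Ioo 0 1))
      (nhds (semicircleIntegral (-1 / 2) 1)) := by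
  refine tendsto_integral_filter_of_dominated_convergence (fun _ => √2) ?_ ?_
    intervalIntegrable_const ?_
  · filter_upwards [self_mem_nhdsWithin] with s hs
    exact (intervalIntegrable_iff.mp (intervalIntegrable_semicircle _
      (by rw [abs_of_pos hs.1]; exact hs.2))).aestronglyMeasurable
  · filter_upwards [self_mem_nhdsWithin] with s hs
    refine .of_forall fun x hx => ?_
    rw [Set.uIoc_of_le (by norm_num)] at hx
    have hy := one_add_mul_pos (s := s) (by rw [abs_of_pos hs.1]; exact hs.2)
      (Set.Ioc_subset_Icc_self hx)
    have hle : 1 - x ^ 2 ≤ 2 * (1 + s * x) := by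
      nlinarith [mul_nonneg (sub_nonneg.mpr hs.2.le) (by linarith [hx.1] : 0 ≤ 1 + x),
        mul_nonneg hs.1.le (sq_nonneg (1 + x)), hs.1, hs.2, sq_nonneg x, sq_nonneg (1 + x)]
    rw [norm_of_nonneg (by positivity), show (-1 / 2 : ℝ) = -(1 / 2) by norm_num,
      rpow_neg hy.le, ← sqrt_eq_rpow, inv_mul_le_iff₀ (sqrt_pos.mpr hy), mul_comm,
      ← sqrt_mul two_pos.le]
    exact sqrt_le_sqrt hle
  · refine .of_forall fun x hx => ?_
    rw [Set.uIoc_of_le (by norm_num)] at hx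
    refine Tendsto.mono_left ?_ nhdsWithin_le_nhds
    have hp : 1 + 1 * x ≠ 0 := by linarith [hx.1]
    have hc : ContinuousAt (fun s : ℝ => 1 + s * x) 1 := by fun_prop
    exact (hc.rpow_const (Or.inl hp)).tendsto.mul_const _

/-- The ratio `Ī₂ / Ī₀` as a function of `s = √(1 + h)`. -/
noncomputable def semicircleRatio (s : ℝ) : ℝ :=
  semicircleIntegral (1 / 2) s / semicircleIntegral (-1 / 2) s

lemma Ibar_ratio_eq {h : ℝ} (hh : h ∈ Set.Ioo (-1 : ℝ) 0) :
    Ibar 2 h / Ibar 0 h = semicircleRatio (√(1 + h)) := by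
  have h0 : (1 + h) / 2 ≠ 0 := by linarith [hh.1]
  rw [Ibar_eq_semicircleIntegral 2 hh, Ibar_eq_semicircleIntegral 0 hh,
    mul_div_mul_left _ _ h0, semicircleRatio]
  norm_num

lemma exists_hasDerivAt_semicircleRatio_neg {s : ℝ} (hs : s ∈ Set.Ioo (0 : ℝ) 1) :
    ∃ d < 0, HasDerivAt semicircleRatio d s := by
  have habs : |s| < 1 := by rw [abs_of_pos hs.1]; exact hs.2
  have hJ2 := semicircleIntegral_pos (1 / 2) habs
  have hJ0 := semicircleIntegral_pos (-1 / 2) habs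
  refine ⟨_, ?_, (hasDerivAt_semicircleIntegral (1 / 2) habs).div
    (hasDerivAt_semicircleIntegral (-1 / 2) habs) hJ0.ne'⟩
  have hM := integral_mul_one_add_mul_rpow_neg (q := 1 / 2 - 1) (by norm_num) hs
  have hN := integral_mul_one_add_mul_rpow_neg (q := -1 / 2 - 1) (by norm_num) hs
  apply div_neg_of_neg_of_pos _ (by positivity)
  nlinarith [mul_neg_of_neg_of_pos hM hJ0, mul_neg_of_neg_of_pos hN hJ2]

lemma sqrt_one_add_mem_Ioo {h : ℝ} (hh : h ∈ Set.Ioo (-1 : ℝ) 0) :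
    √(1 + h) ∈ Set.Ioo (0 : ℝ) 1 :=
  ⟨sqrt_pos.mpr (by linarith [hh.1]),
    (sqrt_lt' one_pos).mpr (by linarith [hh.2])⟩

/-- For every `h ∈ (−1,0)` one has `Ī₀(h) > 0`, the function
`v = Ī₂/Ī₀` is differentiable on `(−1,0)` with `v′ < 0` there; moreover `v(h) → 1` as
`h → −1⁺` and `v(h) → 4/5` as `h → 0⁻`. -/
theorem stmt8 :
    (∀ h ∈ Set.Ioo (-1 : ℝ) 0, 0 < Ibar 0 h) ∧
    (∀ h ∈ Set.Ioo (-1 : ℝ) 0,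
      DifferentiableAt ℝ (fun t => Ibar 2 t / Ibar 0 t) h ∧
      deriv (fun t => Ibar 2 t / Ibar 0 t) h < 0) ∧
    Tendsto (fun t => Ibar 2 t / Ibar 0 t) (nhdsWithin (-1) (Set.Ioi (-1 : ℝ))) (nhds 1) ∧
    Tendsto (fun t => Ibar 2 t / Ibar 0 t) (nhdsWithin 0 (Set.Iio (0 : ℝ))) (nhds (4 / 5)) := by
  refine ⟨fun h hh => ?_, fun h hh => ?_, ?_, ?_⟩
  · have hs := sqrt_one_add_mem_Ioo hh
    rw [Ibar_eq_semicircleIntegral 0 hh]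
    have h1 : 0 < 1 + h := by linarith [hh.1]
    have h2 := semicircleIntegral_pos (((0 : ℕ) - 1) / 2)
      (s := √(1 + h)) (by rw [abs_of_pos hs.1]; exact hs.2)
    positivity
  · have hs := sqrt_one_add_mem_Ioo hh
    obtain ⟨d, hd, hderiv⟩ := exists_hasDerivAt_semicircleRatio_neg hs
    have hsqrt : HasDerivAt (fun t : ℝ => √(1 + t)) (1 / (2 * √(1 + h))) h :=
      ((hasDerivAt_id h).const_add 1).sqrt (by simp only [id]; linarith [hh.1])
    have hcomp : HasDerivAt (fun t => Ibar 2 t / Ibar 0 t) (d * (1 / (2 * √(1 + h)))) h := by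
      refine (hderiv.comp h hsqrt).congr_of_eventuallyEq ?_
      filter_upwards [isOpen_Ioo.mem_nhds hh] with t ht
      exact Ibar_ratio_eq ht
    refine ⟨hcomp.differentiableAt, ?_⟩
    rw [hcomp.deriv]
    have := hs.1
    exact mul_neg_of_neg_of_pos hd (by positivity)
  · have h0 : |(0 : ℝ)| < 1 := by norm_num
    have hcont : ContinuousAt semicircleRatio (√(1 + -1)) := by
      rw [add_neg_cancel, sqrt_zero]
      exact (hasDerivAt_semicircleIntegral _ h0).continuousAt.div
        (hasDerivAt_semicircleIntegral _ h0).continuousAt (semicircleIntegral_pos _ h0).ne'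
    have hsqrt : ContinuousAt (fun t : ℝ => √(1 + t)) (-1) := by fun_prop
    have hone : semicircleRatio (√(1 + -1)) = 1 := by
      have h1 := semicircleIntegral_pos 1 h0
      simp only [semicircleIntegral, semicircleRatio, add_neg_cancel, sqrt_zero, zero_mul,
        add_zero, one_rpow] at h1 ⊢
      exact div_self h1.ne'
    have hlim := (ContinuousAt.comp (f := fun t : ℝ => √(1 + t)) hcont hsqrt).tendsto
    rw [Function.comp_apply, hone] at hlim
    refine (hlim.mono_left nhdsWithin_le_nhds).congr' ?_
    filter_upwards [Ioo_mem_nhdsGT (by norm_num : (-1 : ℝ) < 0)] with t ht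
    exact (Ibar_ratio_eq ht).symm
  · have hmem : ∀ᶠ t in nhdsWithin (0 : ℝ) (Set.Iio 0), t ∈ Set.Ioo (-1 : ℝ) 0 :=
      Ioo_mem_nhdsLT (by norm_num)
    have hratio : Tendsto semicircleRatio (nhdsWithin 1 (Set.Ioo 0 1)) (nhds (4 / 5)) := by
      have hne : semicircleIntegral (-1 / 2) 1 ≠ 0 := by
        rw [semicircleIntegral_neg_half_one]; positivity
      have hlim := tendsto_semicircleIntegral_half.div tendsto_semicircleIntegral_neg_half hne
      rw [semicircleIntegral_half_one, ← semicircleIntegral_neg_half_one,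
        mul_div_cancel_right₀ _ hne] at hlim
      exact hlim
    have hsqrt : Tendsto (fun t : ℝ => √(1 + t)) (nhdsWithin 0 (Set.Iio 0))
        (nhdsWithin 1 (Set.Ioo 0 1)) := by
      refine tendsto_nhdsWithin_iff.mpr ⟨Tendsto.mono_left ?_ nhdsWithin_le_nhds, ?_⟩
      · have hc : Continuous fun t : ℝ => √(1 + t) := by fun_prop
        simpa using hc.tendsto 0
      · filter_upwards [hmem] with t ht using sqrt_one_add_mem_Ioo ht
    refine (hratio.comp hsqrt).congr' ?_
    filter_upwards [hmem] with t ht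
    exact (Ibar_ratio_eq ht).symm
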